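/- arXiv:1204.0877 — 3 statements merged into one kernel-verified Lean document; each statement's English description precedes it below -/
import Mathlib

section
/- For every real number r ≥ 1 and every positive integer n, the quantity φ_n(r) := (r/(r+1))·(n+1)^((r+1)/r) − (1/2)·(n+1)^(1/r) − ∑_{x=1}^{n} x^(1/r) satisfies 0 ≤ φ_n(r) ≤ 1/2. -/
open Real Finset

/-- The graph of `t ↦ t ^ a`, `0 ≤ a ≤ 1`, lies below its tangent lines. -/
lemma rpow_le_tangent {a x y : ℝ} (ha0 : 0 ≤ a) (ha1 : a ≤ 1) (hx : 0 < x) (hy : 0 ≤ y) :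
    y ^ a ≤ x ^ a + a * x ^ (a - 1) * (y - x) := by
  have h := rpow_one_add_le_one_add_mul_self (s := y / x - 1) (p := a)
    (by have := div_nonneg hy hx.le; linarith) ha0 ha1
  rw [add_sub_cancel, Real.div_rpow hy hx.le, div_le_iff₀ (rpow_pos_of_pos hx a)] at h
  refine h.trans_eq ?_
  rw [Real.rpow_sub_one hx.ne']
  field_simp

lemma hasDerivAt_rpow_one_add_div {a x : ℝ} (ha : 0 ≤ a) (hx : 0 < x) :
    HasDerivAt (fun t : ℝ => t ^ (1 + a) / (1 + a)) (x ^ a) x := by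
  have h := (Real.hasDerivAt_rpow_const (p := 1 + a) (Or.inl hx.ne')).div_const (1 + a)
  refine h.congr_deriv ?_
  rw [add_sub_cancel_left]
  field_simp

/-- The trapezoidal rule underestimates the integral of the concave function `t ↦ t ^ a`. -/
lemma trapezoid_le_rpow_primitive_sub {a x y : ℝ} (ha0 : 0 ≤ a) (ha1 : a ≤ 1) (hx : 0 < x)
    (hxy : x ≤ y) :
    (y - x) * (x ^ a + y ^ a) / 2 ≤ y ^ (1 + a) / (1 + a) - x ^ (1 + a) / (1 + a) := by
  have hd : ∀ t, 0 < t → HasDerivAt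
      (fun t : ℝ => t ^ (1 + a) / (1 + a) - (t - x) * (x ^ a + t ^ a) / 2)
      (t ^ a - (1 * (x ^ a + t ^ a) + (t - x) * (a * t ^ (a - 1))) / 2) t := fun t ht =>
    (hasDerivAt_rpow_one_add_div ha0 ht).sub
      ((((hasDerivAt_id t).sub_const x).mul
        ((Real.hasDerivAt_rpow_const (Or.inl ht.ne')).const_add (x ^ a))).div_const 2)
  have hm := monotoneOn_of_hasDerivWithinAt_nonneg (convex_Ici x)
    (fun t ht => (hd t (hx.trans_le ht)).continuousAt.continuousWithinAt)
    (fun t ht => (hd t (hx.trans_le (interior_subset ht))).hasDerivWithinAt)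
    (fun t ht => by
      have ht' : x ≤ t := interior_subset ht
      have := rpow_le_tangent ha0 ha1 (hx.trans_le ht') hx.le
      nlinarith)
  have h := hm Set.self_mem_Ici (Set.mem_Ici.2 hxy) hxy
  simp only [sub_self, zero_mul, zero_div, sub_zero] at h
  linarith

/-- The integral of `t ↦ t ^ a` is at most the integral of its tangent at the left end point. -/
lemma rpow_primitive_sub_le {a x y : ℝ} (ha0 : 0 ≤ a) (ha1 : a ≤ 1) (hx : 0 < x) (hxy : x ≤ y) :
    y ^ (1 + a) / (1 + a) - x ^ (1 + a) / (1 + a) ≤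
      (y - x) * x ^ a + a * x ^ (a - 1) * (y - x) ^ 2 / 2 := by
  have hd : ∀ t, 0 < t → HasDerivAt
      (fun t : ℝ => (t - x) * x ^ a + a * x ^ (a - 1) * (t - x) ^ 2 / 2 - t ^ (1 + a) / (1 + a))
      (x ^ a + a * x ^ (a - 1) * (t - x) - t ^ a) t := fun t ht => by
    have h1 := ((hasDerivAt_id t).sub_const x).mul_const (x ^ a)
    have h2 := ((((hasDerivAt_id t).sub_const x).pow 2).const_mul (a * x ^ (a - 1))).div_const 2
    refine ((h1.add h2).sub (hasDerivAt_rpow_one_add_div ha0 ht)).congr_deriv ?_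
    simp only [id]
    push_cast
    ring
  have hm := monotoneOn_of_hasDerivWithinAt_nonneg (convex_Ici x)
    (fun t ht => (hd t (hx.trans_le ht)).continuousAt.continuousWithinAt)
    (fun t ht => (hd t (hx.trans_le (interior_subset ht))).hasDerivWithinAt)
    (fun t ht => by
      have ht' : x ≤ t := interior_subset ht
      have := rpow_le_tangent ha0 ha1 hx (hx.le.trans ht')
      linarith)
  have h := hm Set.self_mem_Ici (Set.mem_Ici.2 hxy) hxy
  simp only [sub_self] at h
  linarith

lemma rpow_sum_defect_bounds {a : ℝ} (ha0 : 0 ≤ a) (ha1 : a ≤ 1) (n : ℕ) :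
    0 ≤ ((n : ℝ) + 1) ^ (1 + a) / (1 + a) - (1 / 2) * ((n : ℝ) + 1) ^ a
        - ∑ x ∈ Finset.Icc 1 n, (x : ℝ) ^ a ∧
    ((n : ℝ) + 1) ^ (1 + a) / (1 + a) - (1 / 2) * ((n : ℝ) + 1) ^ a
        - ∑ x ∈ Finset.Icc 1 n, (x : ℝ) ^ a ≤ 1 / 2 - a / 2 * ((n : ℝ) + 1) ^ (a - 1) := by
  induction n with
  | zero =>
    have hpos : 0 < 1 + a := by linarith
    have h1 : 1 / 2 ≤ 1 / (1 + a) := one_div_le_one_div_of_le hpos (by linarith)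
    have h2 : 1 / (1 + a) ≤ 1 - a / 2 := by
      rw [div_le_iff₀ hpos]
      nlinarith
    simp only [CharP.cast_eq_zero, zero_add, one_rpow, Finset.Icc_eq_empty_of_lt zero_lt_one,
      Finset.sum_empty]
    constructor <;> linarith
  | succ n ih =>
    rw [Finset.sum_Icc_succ_top (by omega)]
    push_cast
    have hx : (0 : ℝ) < (n : ℝ) + 1 := by positivity
    have hxy : (n : ℝ) + 1 ≤ (n : ℝ) + 1 + 1 := by linarith
    have h1 := trapezoid_le_rpow_primitive_sub ha0 ha1 hx hxy
    have h2 := rpow_primitive_sub_le ha0 ha1 hx hxy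
    have h3 := rpow_le_tangent ha0 ha1 (hx.trans_le hxy) hx.le
    rw [add_sub_cancel_left] at h1 h2
    constructor <;> linarith [ih.1, ih.2]

theorem phi_bounds (r : ℝ) (hr : 1 ≤ r) (n : ℕ) (hn : 0 < n) :
    0 ≤ (r / (r + 1)) * ((n : ℝ) + 1) ^ ((r + 1) / r)
        - (1 / 2) * ((n : ℝ) + 1) ^ (1 / r)
        - ∑ x ∈ Finset.Icc 1 n, (x : ℝ) ^ (1 / r) ∧
    (r / (r + 1)) * ((n : ℝ) + 1) ^ ((r + 1) / r)
        - (1 / 2) * ((n : ℝ) + 1) ^ (1 / r)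
        - ∑ x ∈ Finset.Icc 1 n, (x : ℝ) ^ (1 / r) ≤ 1 / 2 := by
  have hr0 : 0 < r := by linarith
  have ha0 : 0 ≤ 1 / r := by positivity
  have h := rpow_sum_defect_bounds ha0 ((div_le_one hr0).2 hr) n
  have he : (r + 1) / r = 1 + 1 / r := by field_simp
  have hc : r / (r + 1) * ((n : ℝ) + 1) ^ ((r + 1) / r)
      = ((n : ℝ) + 1) ^ (1 + 1 / r) / (1 + 1 / r) := by
    rw [← he]
    field_simp
  have hp : 0 ≤ 1 / r / 2 * ((n : ℝ) + 1) ^ (1 / r - 1) := by positivity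
  rw [hc]
  exact ⟨h.1, by linarith [h.2]⟩
end

section
/- For every positive integer n, the function φ_n(r) tends to 1/2 as r → ∞; that is, the limit as r → ∞ of (r/(r+1))·(n+1)^((r+1)/r) − (1/2)·(n+1)^(1/r) − ∑_{x=1}^{n} x^(1/r) equals 1/2. -/
open Real Finset Filter

/-- If `u` tends to `0`, then `a ^ u` tends to `1` for every `a ≠ 0`. -/
theorem tendsto_const_rpow_one {α : Type*} {l : Filter α} {u : α → ℝ} {a : ℝ} (ha : a ≠ 0)
    (hu : Filter.Tendsto u l (nhds 0)) : Filter.Tendsto (fun t => a ^ u t) l (nhds 1) := by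
  simpa [Function.comp_def] using (Real.continuousAt_const_rpow (b := 0) ha).tendsto.comp hu

theorem phi_tendsto_half (n : ℕ) (hn : 0 < n) :
    Filter.Tendsto
      (fun r : ℝ =>
        (r / (r + 1)) * ((n : ℝ) + 1) ^ ((r + 1) / r)
          - (1 / 2) * ((n : ℝ) + 1) ^ (1 / r)
          - ∑ x ∈ Finset.Icc 1 n, (x : ℝ) ^ (1 / r))
      Filter.atTop (nhds (1 / 2)) := by
  have hinv : Tendsto (fun r : ℝ => 1 / r) atTop (nhds 0) := by
    simpa using tendsto_inv_atTop_zero (𝕜 := ℝ)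
  have hpos : (n : ℝ) + 1 ≠ 0 := by positivity
  have hexp : Tendsto (fun r : ℝ => (r + 1) / r) atTop (nhds 1) := by
    have h := hinv.const_add 1
    rw [add_zero] at h
    refine h.congr' ?_
    filter_upwards [eventually_ne_atTop 0] with r hr
    field_simp
  have hcoeff : Tendsto (fun r : ℝ => r / (r + 1)) atTop (nhds 1) := by
    simpa using hexp.inv₀ one_ne_zero
  have hmain : Tendsto (fun r : ℝ => ((n : ℝ) + 1) ^ ((r + 1) / r)) atTop
      (nhds ((n : ℝ) + 1)) := by
    simpa [Function.comp_def] using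
      (Real.continuousAt_const_rpow (b := 1) hpos).tendsto.comp hexp
  have hsum : Tendsto (fun r : ℝ => ∑ x ∈ Finset.Icc 1 n, (x : ℝ) ^ (1 / r)) atTop
      (nhds (∑ _x ∈ Finset.Icc 1 n, (1 : ℝ))) := by
    refine tendsto_finsetSum _ fun x hx => tendsto_const_rpow_one ?_ hinv
    have := (Finset.mem_Icc.mp hx).1
    positivity
  convert ((hcoeff.mul hmain).sub ((tendsto_const_rpow_one hpos hinv).const_mul (1 / 2))).sub hsum
    using 2
  simp only [Finset.sum_const, Nat.card_Icc, Nat.add_sub_cancel, nsmul_eq_mul]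
  ring
end

section
/- For every positive integer n, the function r ↦ (r/(r+1))·(n+1)^((r+1)/r) − (1/2)·(n+1)^(1/r) − ∑_{x=1}^{n} x^(1/r) is monotone nondecreasing on the interval [1, ∞). -/
open Real Finset

lemma nonpos_of_hasDerivAt_nonpos {f f' : ℝ → ℝ} {a b : ℝ} (ha : f a ≤ 0)
    (hf : ∀ t ∈ Set.Icc a b, HasDerivAt f (f' t) t) (hf' : ∀ t ∈ Set.Icc a b, f' t ≤ 0) :
    ∀ t ∈ Set.Icc a b, f t ≤ 0 := by
  intro t ht
  have hanti : AntitoneOn f (Set.Icc a b) := by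
    refine antitoneOn_of_deriv_nonpos (convex_Icc a b)
      (fun x hx => (hf x hx).continuousAt.continuousWithinAt)
      (fun x hx => (hf x (interior_subset hx)).differentiableAt.differentiableWithinAt) ?_
    intro x hx
    rw [(hf x (interior_subset hx)).deriv]
    exact hf' x (interior_subset hx)
  exact (hanti ⟨le_rfl, ht.1.trans ht.2⟩ ht ht.1).trans ha

/-- One-sided error bound for the trapezoidal rule with end correction on `[a, a + 1]`,
applied to `h = H'`. -/
lemma corrected_trapezoid_error_le {H h h1 h2 h3 h4 : ℝ → ℝ} {a M : ℝ}
    (dH : ∀ t ∈ Set.Icc a (a + 1), HasDerivAt H (h t) t)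
    (dh : ∀ t ∈ Set.Icc a (a + 1), HasDerivAt h (h1 t) t)
    (dh1 : ∀ t ∈ Set.Icc a (a + 1), HasDerivAt h1 (h2 t) t)
    (dh2 : ∀ t ∈ Set.Icc a (a + 1), HasDerivAt h2 (h3 t) t)
    (dh3 : ∀ t ∈ Set.Icc a (a + 1), HasDerivAt h3 (h4 t) t)
    (hM : ∀ t ∈ Set.Icc a (a + 1), h4 t ≤ M) :
    H (a + 1) - H a - (h (a + 1) + h a) / 2 + (h1 (a + 1) - h1 a) / 12 ≤ M / 720 := by
  have ds (t : ℝ) : HasDerivAt (fun t : ℝ => t - a) 1 t := (hasDerivAt_id t).sub_const a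
  have second : ∀ t ∈ Set.Icc a (a + 1),
      (h1 t - h1 a) / 6 - (t - a) / 6 * h2 t + (t - a) ^ 2 / 12 * h3 t
        - M / 36 * (t - a) ^ 3 ≤ 0 := by
    refine nonpos_of_hasDerivAt_nonpos (f' := fun t => (t - a) ^ 2 / 12 * (h4 t - M))
      (by simp) (fun t ht => ?_) (fun t ht => ?_)
    · have := (((((dh1 t ht).sub_const (h1 a)).div_const 6).sub
        (((ds t).div_const 6).mul (dh2 t ht))).add
        ((((ds t).pow 2).div_const 12).mul (dh3 t ht))).sub (((ds t).pow 3).const_mul (M / 36))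
      refine this.congr_deriv ?_
      simp
      ring
    · exact mul_nonpos_of_nonneg_of_nonpos (by positivity) (sub_nonpos.2 (hM t ht))
  have first : ∀ t ∈ Set.Icc a (a + 1),
      (h t - h a) / 2 - (t - a) / 3 * h1 t - (t - a) / 6 * h1 a + (t - a) ^ 2 / 12 * h2 t
        - M / 144 * (t - a) ^ 4 ≤ 0 := by
    refine nonpos_of_hasDerivAt_nonpos (by simp) (fun t ht => ?_) second
    have := ((((((dh t ht).sub_const (h a)).div_const 2).sub
      (((ds t).div_const 3).mul (dh1 t ht))).sub (((ds t).div_const 6).mul_const (h1 a))).add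
      ((((ds t).pow 2).div_const 12).mul (dh2 t ht))).sub (((ds t).pow 4).const_mul (M / 144))
    refine this.congr_deriv ?_
    simp
    ring
  have zeroth : ∀ t ∈ Set.Icc a (a + 1),
      (H t - H a) - (t - a) / 2 * (h t + h a) + (t - a) ^ 2 / 12 * (h1 t - h1 a)
        - M / 720 * (t - a) ^ 5 ≤ 0 := by
    refine nonpos_of_hasDerivAt_nonpos (by simp) (fun t ht => ?_) first
    have := ((((dH t ht).sub_const (H a)).sub
      (((ds t).div_const 2).mul ((dh t ht).add_const (h a)))).add
      ((((ds t).pow 2).div_const 12).mul ((dh1 t ht).sub_const (h1 a)))).sub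
      (((ds t).pow 5).const_mul (M / 720))
    refine this.congr_deriv ?_
    simp
    ring
  have := zeroth (a + 1) ⟨by linarith, le_rfl⟩
  norm_num at this
  linarith

lemma hasDerivAt_const_mul_rpow_sub {c d e f c' d' e' f' t : ℝ} (ht : 0 < t)
    (hc : c' = c * e) (he : e' = e - 1) (hd : d' = d * f) (hf : f' = f - 1) :
    HasDerivAt (fun t : ℝ => c * t ^ e - d * t ^ f) (c' * t ^ e' - d' * t ^ f') t := by
  subst hc he hd hf
  refine (((hasDerivAt_rpow_const (p := e) (Or.inl ht.ne')).const_mul c).sub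
    ((hasDerivAt_rpow_const (p := f) (Or.inl ht.ne')).const_mul d)).congr_deriv ?_
  ring

lemma rpow_fourth_deriv_sub_le {p q a t : ℝ} (hp : 0 ≤ p) (hpq : p ≤ q) (hq : q ≤ 1)
    (ha : 1 ≤ a) (hat : a ≤ t) :
    q * (q - 1) * (q - 2) * (q - 3) * t ^ (q - 4) - p * (p - 1) * (p - 2) * (p - 3) * t ^ (p - 4)
      ≤ 6 * (q - p) / a ^ 3 := by
  have ht : 1 ≤ t := ha.trans hat
  have hmono : t ^ (p - 4) ≤ t ^ (q - 4) := rpow_le_rpow_of_exponent_le ht (by linarith)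
  have hneg : q * (q - 1) * (q - 2) * (q - 3) ≤ 0 := by
    have h : 0 ≤ q * (1 - q) * (2 - q) * (3 - q) :=
      mul_nonneg (mul_nonneg (mul_nonneg (by linarith) (by linarith)) (by linarith)) (by linarith)
    linarith
  have hpoly : q * (q - 1) * (q - 2) * (q - 3) - p * (p - 1) * (p - 2) * (p - 3)
      ≤ 6 * (q - p) := by
    have hfac : 6 * (q - p) -
        (q * (q - 1) * (q - 2) * (q - 3) - p * (p - 1) * (p - 2) * (p - 3)) =
        (q - p) * (12 - 11 * (q + p) + 6 * (q ^ 2 + q * p + p ^ 2)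
          - (q + p) * (q ^ 2 + p ^ 2)) := by ring
    have : 0 ≤ 12 - 11 * (q + p) + 6 * (q ^ 2 + q * p + p ^ 2) - (q + p) * (q ^ 2 + p ^ 2) := by
      nlinarith [sq_nonneg (q - p), sq_nonneg (q + p - 1), mul_nonneg hp (hp.trans hpq),
        mul_nonneg (by linarith : 0 ≤ 2 - (q + p)) (add_nonneg (sq_nonneg q) (sq_nonneg p))]
    nlinarith [mul_nonneg (sub_nonneg.2 hpq) this]
  have hbound : t ^ (p - 4) ≤ 1 / a ^ 3 := by
    calc t ^ (p - 4) ≤ t ^ (-3 : ℝ) := rpow_le_rpow_of_exponent_le ht (by linarith)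
      _ ≤ a ^ (-3 : ℝ) := rpow_le_rpow_of_nonpos (by linarith) hat (by norm_num)
      _ = 1 / a ^ 3 := by
        rw [rpow_neg (by linarith), one_div]
        norm_cast
  have hpos : 0 ≤ t ^ (p - 4) := by positivity
  calc _ ≤ q * (q - 1) * (q - 2) * (q - 3) * t ^ (p - 4)
        - p * (p - 1) * (p - 2) * (p - 3) * t ^ (p - 4) :=
        sub_le_sub_right (mul_le_mul_of_nonpos_left hmono hneg) _
    _ = (q * (q - 1) * (q - 2) * (q - 3) - p * (p - 1) * (p - 2) * (p - 3)) * t ^ (p - 4) := by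
        ring
    _ ≤ 6 * (q - p) * t ^ (p - 4) := mul_le_mul_of_nonneg_right hpoly hpos
    _ ≤ 6 * (q - p) * (1 / a ^ 3) := mul_le_mul_of_nonneg_left hbound (by linarith)
    _ = _ := by ring

lemma corrected_trapezoid_rpow_sub_le {p q a : ℝ} (hp : 0 ≤ p) (hpq : p ≤ q) (hq : q ≤ 1)
    (ha : 1 ≤ a) :
    (1 / (1 + q) * (a + 1) ^ (1 + q) - 1 / (1 + p) * (a + 1) ^ (1 + p))
        - (1 / (1 + q) * a ^ (1 + q) - 1 / (1 + p) * a ^ (1 + p))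
        - (((a + 1) ^ q - (a + 1) ^ p) + (a ^ q - a ^ p)) / 2
        + ((q * (a + 1) ^ (q - 1) - p * (a + 1) ^ (p - 1))
          - (q * a ^ (q - 1) - p * a ^ (p - 1))) / 12
      ≤ (q - p) / 6 * (1 / a - 1 / (a + 1)) := by
  have hp1 : 1 + p ≠ 0 := by linarith
  have hq1 : 1 + q ≠ 0 := by linarith
  have hpos : ∀ t ∈ Set.Icc a (a + 1), 0 < t := fun t ht => by linarith [ht.1]
  have key := corrected_trapezoid_error_le (a := a) (M := 6 * (q - p) / a ^ 3)
    (H := fun t => 1 / (1 + q) * t ^ (1 + q) - 1 / (1 + p) * t ^ (1 + p))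
    (h := fun t => 1 * t ^ q - 1 * t ^ p)
    (h1 := fun t => q * t ^ (q - 1) - p * t ^ (p - 1))
    (h2 := fun t => q * (q - 1) * t ^ (q - 2) - p * (p - 1) * t ^ (p - 2))
    (h3 := fun t => q * (q - 1) * (q - 2) * t ^ (q - 3) - p * (p - 1) * (p - 2) * t ^ (p - 3))
    (h4 := fun t => q * (q - 1) * (q - 2) * (q - 3) * t ^ (q - 4)
      - p * (p - 1) * (p - 2) * (p - 3) * t ^ (p - 4))
    (fun t ht => hasDerivAt_const_mul_rpow_sub (hpos t ht) (by field_simp) (by ring)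
      (by field_simp) (by ring))
    (fun t ht => hasDerivAt_const_mul_rpow_sub (hpos t ht) (by ring) (by ring) (by ring) (by ring))
    (fun t ht => hasDerivAt_const_mul_rpow_sub (hpos t ht) (by ring) (by ring) (by ring) (by ring))
    (fun t ht => hasDerivAt_const_mul_rpow_sub (hpos t ht) (by ring) (by ring) (by ring) (by ring))
    (fun t ht => hasDerivAt_const_mul_rpow_sub (hpos t ht) (by ring) (by ring) (by ring) (by ring))
    (fun t ht => rpow_fourth_deriv_sub_le hp hpq hq ha ht.1)
  simp only [one_mul] at key
  refine key.trans ?_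
  have hfrac : 1 / (20 * a ^ 3) ≤ 1 / a - 1 / (a + 1) := by
    rw [div_sub_div _ _ (by linarith) (by linarith), div_le_div_iff₀ (by positivity)
      (by positivity)]
    nlinarith [mul_nonneg (by linarith : 0 ≤ a) (by linarith : 0 ≤ a - 1),
      mul_nonneg (sq_nonneg a) (by linarith : 0 ≤ a - 1)]
  calc 6 * (q - p) / a ^ 3 / 720 = (q - p) / 6 * (1 / (20 * a ^ 3)) := by
        ring
    _ ≤ _ := mul_le_mul_of_nonneg_left hfrac (by linarith)

lemma corrected_sum_rpow_error_antitone (n : ℕ) {p q : ℝ} (hp : 0 ≤ p) (hpq : p ≤ q)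
    (hq : q ≤ 1) :
    1 / (1 + q) * ((n : ℝ) + 1) ^ (1 + q) - 1 / 2 * ((n : ℝ) + 1) ^ q
        - ∑ x ∈ Icc 1 n, (x : ℝ) ^ q + q * ((n : ℝ) + 1) ^ (q - 1) / 12 + q / 6 / ((n : ℝ) + 1)
      ≤ 1 / (1 + p) * ((n : ℝ) + 1) ^ (1 + p) - 1 / 2 * ((n : ℝ) + 1) ^ p
        - ∑ x ∈ Icc 1 n, (x : ℝ) ^ p + p * ((n : ℝ) + 1) ^ (p - 1) / 12
        + p / 6 / ((n : ℝ) + 1) := by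
  induction n with
  | zero =>
    have hdiff : (q - p) / 4 ≤ 1 / (1 + p) - 1 / (1 + q) := by
      rw [div_sub_div _ _ (by linarith) (by linarith), div_le_div_iff₀ (by norm_num)
        (mul_pos (by linarith) (by linarith))]
      nlinarith [mul_nonneg (sub_nonneg.2 hpq)
        (by nlinarith : 0 ≤ 4 - (1 + p) * (1 + q))]
    simp
    simp only [one_div] at hdiff
    linarith
  | succ n ih =>
    have key := corrected_trapezoid_rpow_sub_le hp hpq hq
      (a := (n : ℝ) + 1) (by linarith [n.cast_nonneg (α := ℝ)])
    rw [sum_Icc_succ_top (by omega), sum_Icc_succ_top (by omega)]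
    push_cast
    ring_nf at key ih ⊢
    linarith

theorem phi_monotone (n : ℕ) (hn : 0 < n) :
    MonotoneOn
      (fun r : ℝ =>
        (r / (r + 1)) * ((n : ℝ) + 1) ^ ((r + 1) / r)
          - (1 / 2) * ((n : ℝ) + 1) ^ (1 / r)
          - ∑ x ∈ Finset.Icc 1 n, (x : ℝ) ^ (1 / r))
      (Set.Ici (1 : ℝ)) := by
  intro r hr s hs hrs
  simp only [Set.mem_Ici] at hr hs
  have hr0 : 0 < r := by linarith
  have hs0 : 0 < s := by linarith
  have hp : 0 ≤ 1 / s := by positivity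
  have hpq : 1 / s ≤ 1 / r := one_div_le_one_div_of_le hr0 hrs
  have hq : 1 / r ≤ 1 := (div_le_one hr0).2 hr
  have key := corrected_sum_rpow_error_antitone n hp hpq hq
  have hN : (1 : ℝ) ≤ n + 1 := by linarith [n.cast_nonneg (α := ℝ)]
  have hcorr : 1 / s * ((n : ℝ) + 1) ^ (1 / s - 1) ≤ 1 / r * ((n : ℝ) + 1) ^ (1 / r - 1) :=
    mul_le_mul hpq (rpow_le_rpow_of_exponent_le hN (by linarith)) (by positivity) (by positivity)
  have hlin : 1 / s / 6 / ((n : ℝ) + 1) ≤ 1 / r / 6 / ((n : ℝ) + 1) := by gcongr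
  have coef {r : ℝ} (h : 0 < r) : r / (r + 1) = 1 / (1 + 1 / r) := by
    field_simp
  have expo {r : ℝ} (h : 0 < r) : (r + 1) / r = 1 + 1 / r := by
    field_simp
  simp only [coef hr0, coef hs0, expo hr0, expo hs0]
  linarith
end
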